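/- arXiv:1904.01285 — 2 statements merged into one kernel-verified Lean document; each statement's English description precedes it below -/
import Mathlib

section
/- Let X and Y be first-countable topological spaces, f : X → Y an open quotient map, E ⊆ Y² a symmetric reflexive closed relation, and F = (f × f)⁻¹(E). Then F^(λ) = (f × f)⁻¹(E^(λ)) for all ordinals λ. -/
open Filter Topology Set

namespace CPE

universe u

/-- The left shift map on bi-infinite sequences: `(σ x) i = x (i+1)`. -/
def shiftMap {A : Type*} (x : ℤ → A) : ℤ → A := fun i => x (i + 1)

/-- The shift by `m`: `(σ^m x) i = x (i + m)`. -/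
def shiftZ {A : Type*} (m : ℤ) (x : ℤ → A) : ℤ → A := fun i => x (i + m)

/-- A subshift: a closed shift-invariant subset of the full shift. -/
def IsSubshift {A : Type*} [TopologicalSpace A] (X : Set (ℤ → A)) : Prop :=
  IsClosed X ∧ shiftMap '' X = X

/-- The orbit closure of a point. -/
def orbitClosure {A : Type*} [TopologicalSpace A] (x : ℤ → A) : Set (ℤ → A) :=
  closure {y | ∃ m : ℤ, y = shiftZ m x}

/-- A Toeplitz point: every coordinate repeats along some arithmetic progression. -/
def IsToeplitz {A : Type*} (x : ℤ → A) : Prop :=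
  ∀ i : ℤ, ∃ n : ℕ, 0 < n ∧ ∀ m : ℤ, x (i + m * n) = x i

/-- A minimal subshift: a nonempty subshift with no nonempty proper subshift. -/
def IsMinimalSubshift {A : Type*} [TopologicalSpace A] (M : Set (ℤ → A)) : Prop :=
  IsSubshift M ∧ M.Nonempty ∧ ∀ M' ⊆ M, IsSubshift M' → M'.Nonempty → M' = M

/-- The words of length `n` appearing in points of `X`. -/
def lang {A : Type*} (X : Set (ℤ → A)) (n : ℕ) : Set (Fin n → A) :=
  {w | ∃ x ∈ X, ∀ i : Fin n, x (i : ℤ) = w i}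

/-- `X` has zero (topological) entropy: `lim (log |L_n(X)|)/n = 0`. -/
def HasZeroEntropy {A : Type*} (X : Set (ℤ → A)) : Prop :=
  Tendsto (fun n : ℕ => Real.log ((lang X n).ncard) / n) atTop (nhds 0)

/-- `N(𝒰 ∨ σ⁻¹𝒰 ∨ ⋯ ∨ σ^{-(n-1)}𝒰)` for the two-element cover `𝒰 = (C0, C1)`:
the minimal number of sets of the form `⋂_{i<n} σ^{-i} C_{u i}` needed to cover `X`. -/
noncomputable def coverNum {A : Type*} (X C0 C1 : Set (ℤ → A)) (n : ℕ) : ℕ :=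
  sInf {m | ∃ S : Finset (Fin n → Bool), S.card = m ∧
    X ⊆ ⋃ u ∈ S, ⋂ i : Fin n, shiftMap^[(i : ℕ)] ⁻¹' (if u i then C1 else C0)}

/-- The topological entropy `h(𝒰)` of the two-element cover `𝒰 = (C0, C1)` of a subshift `X`.
By subadditivity (Fekete's lemma) the limit `lim_n (1/n) log N_n` exists and equals the
infimum `⨅_{n ≥ 1} (1/n) log N_n`, which we use as the definition. -/
noncomputable def coverEntropy {A : Type*} (X C0 C1 : Set (ℤ → A)) : ℝ :=
  ⨅ n : ℕ, Real.log (coverNum X C0 C1 (n + 1)) / (n + 1)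

/-- `(x, y)` is an entropy pair of the subshift `X`: `x ≠ y` and for all disjoint closed
neighborhoods `U` of `x` and `V` of `y` (in `X`), the cover `(Uᶜ, Vᶜ)` has positive entropy. -/
def IsEntropyPair {A : Type*} [TopologicalSpace A] (X : Set (ℤ → A)) (x y : ℤ → A) : Prop :=
  x ∈ X ∧ y ∈ X ∧ x ≠ y ∧
    ∀ U V : Set (ℤ → A), IsClosed U → IsClosed V → U ∈ nhdsWithin x X → V ∈ nhdsWithin y X →
      Disjoint U V → 0 < coverEntropy X Uᶜ Vᶜ

/-- `EP(X)`: the entropy pairs of `X` together with the diagonal on `X`. -/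
def EP {A : Type*} [TopologicalSpace A] (X : Set (ℤ → A)) : Set ((ℤ → A) × (ℤ → A)) :=
  {p | IsEntropyPair X p.1 p.2} ∪ {p | p.1 ∈ X ∧ p.1 = p.2}

/-- The close-up process on a relation `E`: `E^(0) = E`; at a successor step `α + 1` one takes
the topological closure if `α + 1` is odd (i.e. `α` is even), and the transitive closure if
`α + 1` is even (i.e. `α` is odd); at limit steps one takes the union.  (An ordinal is even
iff it is of the form `λ + 2n` with `λ` a limit ordinal and `n ∈ ℕ`, iff its residue mod `2`
is `0`.)  When `E` is closed this agrees with the process of Barbieri–García-Ramos started at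
`E^(1) = E`, since then `E^(1) = closure E = E`. -/
noncomputable def closeUp {α : Type u} [TopologicalSpace α] (E : Set (α × α))
    (o : Ordinal.{u}) : Set (α × α) :=
  Ordinal.limitRecOn o E
    (fun β ih => if β % 2 = 0 then closure ih
      else {p | Relation.TransGen (fun a b => (a, b) ∈ ih) p.1 p.2})
    (fun β _ ih => ⋃ γ : Set.Iio β, ih γ.1 γ.2)

/-- The close-up rank of `E`: the least ordinal `λ` (with `λ ≥ 1` if `E` is closed, matching
the convention `E^(ζ) = E`, `ζ = 1` for closed `E`) such that `E^(λ) = E^(λ+1)`. -/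
noncomputable def closeUpRank {α : Type u} [TopologicalSpace α] (E : Set (α × α)) :
    Ordinal.{u} :=
  sInf {o | (IsClosed E → 1 ≤ o) ∧ closeUp E o = closeUp E (o + 1)}

/-- `E^[k] = {(x₁, …, x_k) : ∀ i j, (x_i, x_j) ∈ E}`. -/
def relPow {α : Type*} (E : Set (α × α)) (k : ℕ) : Set (Fin k → α) :=
  {v | ∀ i j, (v i, v j) ∈ E}

/-- `(E^[k])²` viewed inside `α^{k+k}` via concatenation of the two `k`-tuples. -/
def pairSet {α : Type*} (E : Set (α × α)) (k : ℕ) : Set (Fin (k + k) → α) :=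
  {w | ∃ u ∈ relPow E k, ∃ v ∈ relPow E k, w = Fin.append u v}

end CPE

namespace CPE

universe u

theorem closeUp_zero {α : Type u} [TopologicalSpace α] (E : Set (α × α)) :
    closeUp E 0 = E :=
  Ordinal.limitRecOn_zero ..

theorem closeUp_add_one {α : Type u} [TopologicalSpace α] (E : Set (α × α)) (o : Ordinal.{u}) :
    closeUp E (o + 1) = if o % 2 = 0 then closure (closeUp E o)
      else {p | Relation.TransGen (fun a b => (a, b) ∈ closeUp E o) p.1 p.2} :=
  Ordinal.limitRecOn_add_one ..

theorem closeUp_limit {α : Type u} [TopologicalSpace α] (E : Set (α × α)) {o : Ordinal.{u}}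
    (ho : Order.IsSuccLimit o) : closeUp E o = ⋃ γ : Set.Iio o, closeUp E γ.1 :=
  Ordinal.limitRecOn_limit _ _ _ _ ho

theorem transGen_preimage_iff {α β : Type*} {f : α → β} (hf : Function.Surjective f)
    (r : β → β → Prop) (a b : α) :
    Relation.TransGen (fun x y => r (f x) (f y)) a b ↔ Relation.TransGen r (f a) (f b) := by
  refine ⟨fun h => h.lift f fun _ _ h => h, fun h => ?_⟩
  generalize hy : f b = y at h
  induction h generalizing b with
  | single h => exact .single (by simpa only [hy] using h)
  | @tail c _ _ hcy ih =>
    obtain ⟨c', rfl⟩ := hf c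
    exact (ih c' rfl).tail (by simpa only [hy] using hcy)

end CPE

open CPE Filter Topology in
/-- If `f : X → Y` is an open quotient map between first-countable spaces, `E ⊆ Y²` is a
symmetric reflexive closed relation and `F = (f × f)⁻¹(E)`, then the close-up processes
correspond: `F^(λ) = (f × f)⁻¹(E^(λ))` for all ordinals `λ`. -/
theorem closeUp_preimage_open_quotient {X Y : Type u} [TopologicalSpace X] [TopologicalSpace Y]
    [FirstCountableTopology X] [FirstCountableTopology Y]
    (f : X → Y) (hq : Topology.IsQuotientMap f) (hopen : IsOpenMap f)
    (E : Set (Y × Y)) (hEclosed : IsClosed E)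
    (hEsym : ∀ p ∈ E, (p.2, p.1) ∈ E) (hErefl : ∀ y : Y, (y, y) ∈ E) :
    ∀ lam : Ordinal.{u},
      closeUp (Prod.map f f ⁻¹' E) lam = Prod.map f f ⁻¹' closeUp E lam := by
  intro lam
  induction lam using Ordinal.limitRecOn with
  | zero => simp only [closeUp_zero]
  | add_one o ih =>
    rw [closeUp_add_one, closeUp_add_one, ih]
    split_ifs
    · exact ((hopen.prodMap hopen).preimage_closure_eq_closure_preimage
        (hq.continuous.prodMap hq.continuous) _).symm
    · ext ⟨a, b⟩
      exact transGen_preimage_iff hq.surjective (fun x y => (x, y) ∈ closeUp E o) a b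
  | limit o ho ih =>
    rw [closeUp_limit _ ho, closeUp_limit _ ho, Set.preimage_iUnion]
    exact Set.iUnion_congr fun γ => ih γ.1 γ.2
end

section
/- Define binary words by w_0 = 1 and w_{i+1} = w_i · 0^{i+1} · w_i, and let w_ω ∈ {0,1}^ℕ be the pointwise limit of the w_i (each w_i is a prefix of w_{i+1}). Then for every k ≥ 1, the prefix of w_ω of length k contains at least k/3 occurrences of the symbol 1, i.e., 3 · |{j < k : (w_ω)_j = 1}| ≥ k. -/
theorem ruler_length_count (w : ℕ → List Bool) (h0 : w 0 = [true])
    (hs : ∀ i, w (i + 1) = w i ++ List.replicate (i + 1) false ++ w i) (i : ℕ) :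
    (w i).length + i + 2 = 3 * 2 ^ i ∧ (w i).count true = 2 ^ i := by
  induction i with
  | zero => simp [h0]
  | succ i ih =>
    rw [hs]
    simp only [List.length_append, List.length_replicate, List.count_append, List.count_replicate]
    simp only [pow_succ]
    refine ⟨by omega, ?_⟩
    simp
    omega

theorem ruler_le_three_mul_count_take (w : ℕ → List Bool) (h0 : w 0 = [true])
    (hs : ∀ i, w (i + 1) = w i ++ List.replicate (i + 1) false ++ w i) (i k : ℕ)
    (hk : k ≤ (w i).length) : k ≤ 3 * ((w i).take k).count true := by
  induction i generalizing k with
  | zero =>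
    rw [h0] at hk ⊢
    simp only [List.length_singleton] at hk
    interval_cases k <;> simp
  | succ i ih =>
    obtain ⟨hl, hc⟩ := ruler_length_count w h0 hs i
    rw [hs] at hk ⊢
    simp only [List.length_append, List.length_replicate] at hk
    rw [List.append_assoc, List.take_append, List.count_append]
    rcases le_total k (w i).length with h | h
    · have := ih k h
      omega
    · rw [List.take_of_length_le h, hc, List.take_append, List.count_append,
        List.length_replicate]
      have := ih (k - (w i).length - (i + 1)) (by omega)
      omega

theorem card_filter_range_eq_count_take (W : ℕ → Bool) (l : List Bool)
    (hW : ∀ j : Fin l.length, W (j : ℕ) = l.get j) (k : ℕ) (hk : k ≤ l.length) :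
    ((Finset.range k).filter (fun j => W j = true)).card = (l.take k).count true := by
  induction k with
  | zero => simp
  | succ k ih =>
    have hget : W k = l[k] := hW ⟨k, hk⟩
    rw [Finset.card_filter, Finset.sum_range_succ, ← Finset.card_filter, ih (by omega),
      List.take_succ_eq_append_getElem hk, List.count_append, List.count_singleton, hget]
    simp


/-- Let `w 0 = 1`, `w (i+1) = w i · 0^{i+1} · w i`, and let `W : ℕ → Bool` be the pointwise
limit of the `w i` (each `w i` is a prefix of `w (i+1)`), i.e. `W j` equals the `j`-th letter
of `w i` whenever `j < |w i|`.  Then every prefix of `W` of length `k ≥ 1` contains at least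
`k/3` occurrences of `1`: `3 · |{j < k : W j = 1}| ≥ k`. -/
theorem ruler_word_density (w : ℕ → List Bool) (h0 : w 0 = [true])
    (hs : ∀ i, w (i + 1) = w i ++ List.replicate (i + 1) false ++ w i)
    (W : ℕ → Bool) (hW : ∀ i : ℕ, ∀ j : Fin (w i).length, W (j : ℕ) = (w i).get j) :
    ∀ k : ℕ, 1 ≤ k → k ≤ 3 * ((Finset.range k).filter (fun j => W j = true)).card := by
  intro k _
  have hk : k ≤ (w k).length := by
    have := (ruler_length_count w h0 hs k).1
    have := Nat.lt_two_pow_self (n := k)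
    omega
  rw [card_filter_range_eq_count_take W (w k) (hW k) k hk]
  exact ruler_le_three_mul_count_take w h0 hs k k hk
end
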